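/- (Proposition 3.13, energy/decay estimate for the parabolic evolution; Proposition 10.4 of Bourgade–Erdős–Yau.) Let K ≥ 1 be an integer and b > 0. Let B : [0, ∞) → ℝ^{K×K} and W : [0, ∞) → ℝ^K be continuous with B_{jk}(t) = B_{kj}(t) ≥ b/(j^{2/3} − k^{2/3})² for all 1 ≤ j ≠ k ≤ K and W_j(t) ≥ b K^{1/3}/((K+1)^{2/3} − j^{2/3}) for all 1 ≤ j ≤ K and all t ≥ 0. Let w : [0, ∞) → ℝ^K be differentiable and solve, for all t > 0 and all i, w_i'(t) = Σ_{j ≠ i, j ≤ K} B_{ij}(t)(w_j(t) − w_i(t)) − W_i(t) w_i(t). Then for all exponents 1 ≤ p ≤ q ≤ ∞ and all sufficiently small η > 0, there is a constant C = C(q, p, η) (independent of K, b, B, W, w) such that for all t > 0, ‖w(t)‖_{ℓ^q} ≤ C ((K^{−2η/3} t b)^{−(3/p − 3/q)})^{1−6η} ‖w(0)‖_{ℓ^p}. -/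

import Mathlib

open Real
open scoped ENNReal

/-- The `ℓ^p` norm of a finite vector, for `p ∈ [1, ∞]`. -/
noncomputable def lpNorm {K : ℕ} (p : ℝ≥0∞) (v : Fin K → ℝ) : ℝ :=
  if p = ⊤ then ⨆ i, |v i| else (∑ i, |v i| ^ p.toReal) ^ (1 / p.toReal)

theorem rpow_two_thirds_sub_sq_le {x y m : ℝ} (hx : 0 ≤ x) (hy : 0 ≤ y) (hm : 0 ≤ m)
    (h : |x - y| ≤ m) :
    (x ^ ((2 : ℝ) / 3) - y ^ ((2 : ℝ) / 3)) ^ 2 ≤ m ^ ((4 : ℝ) / 3) := by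
  have key : ∀ u v : ℝ, 0 ≤ u → 0 ≤ v → u ≤ v + m →
      u ^ ((2 : ℝ) / 3) - v ^ ((2 : ℝ) / 3) ≤ m ^ ((2 : ℝ) / 3) := by
    intro u v hu hv huv
    have h1 := Real.rpow_le_rpow hu huv (by norm_num : (0 : ℝ) ≤ 2 / 3)
    have h2 := Real.rpow_add_le_add_rpow hv hm (by norm_num : (0 : ℝ) ≤ 2 / 3) (by norm_num)
    linarith
  have hsq : m ^ ((4 : ℝ) / 3) = (m ^ ((2 : ℝ) / 3)) ^ 2 := by
    rw [← Real.rpow_natCast, ← Real.rpow_mul hm]; norm_num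
  rw [hsq]
  have h' := abs_le.1 h
  apply sq_le_sq'
  · linarith [key y x hy hx (by linarith)]
  · exact key x y hx hy (by linarith)

/-- The Dirichlet form of the generator, up to a factor `2`. -/
noncomputable def dirichletForm {K : ℕ} (B : Fin K → Fin K → ℝ) (W v : Fin K → ℝ) : ℝ :=
  (∑ i, ∑ j, B i j * (v i - v j) ^ 2) + 2 * ∑ i, W i * v i ^ 2

/-- The lower bounds on the coefficients at a fixed time, together with symmetry. -/
structure IsCoefficient {K : ℕ} (b : ℝ) (B : Fin K → Fin K → ℝ) (W : Fin K → ℝ) : Prop where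
  symm : ∀ j k, B j k = B k j
  le_rate : ∀ j k : Fin K, j ≠ k → b / ((((j : ℕ) + 1 : ℕ) : ℝ) ^ ((2 : ℝ) / 3)
              - (((k : ℕ) + 1 : ℕ) : ℝ) ^ ((2 : ℝ) / 3)) ^ 2 ≤ B j k
  le_potential : ∀ j : Fin K, b * (K : ℝ) ^ ((1 : ℝ) / 3) /
            (((K : ℝ) + 1) ^ ((2 : ℝ) / 3) - (((j : ℕ) + 1 : ℕ) : ℝ) ^ ((2 : ℝ) / 3)) ≤ W j

namespace IsCoefficient

variable {K : ℕ} {b : ℝ} {B : Fin K → Fin K → ℝ} {W : Fin K → ℝ}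

theorem rate_nonneg (h : IsCoefficient b B W) (hb : 0 < b) {i j : Fin K} (hij : i ≠ j) :
    0 ≤ B i j :=
  le_trans (by positivity) (h.le_rate i j hij)

theorem rate_mul_sq_nonneg (h : IsCoefficient b B W) (hb : 0 < b) (v : Fin K → ℝ) (i j : Fin K) :
    0 ≤ B i j * (v i - v j) ^ 2 := by
  rcases eq_or_ne i j with rfl | hij
  · simp
  · exact mul_nonneg (h.rate_nonneg hb hij) (sq_nonneg _)

theorem mul_sq_le_of_abs_sub_le (h : IsCoefficient b B W) (hb : 0 < b) (v : Fin K → ℝ)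
    {i j : Fin K} {m : ℝ} (hm : |((i : ℕ) : ℝ) - (j : ℕ)| ≤ m) :
    b * (v i - v j) ^ 2 ≤ m ^ ((4 : ℝ) / 3) * (B i j * (v i - v j) ^ 2) := by
  rcases eq_or_ne i j with rfl | hij
  · simp
  have hm0 : 0 ≤ m := (abs_nonneg _).trans hm
  have hd := rpow_two_thirds_sub_sq_le (x := ((i : ℕ) + 1 : ℕ)) (y := ((j : ℕ) + 1 : ℕ))
    (by positivity) (by positivity) hm0 (by push_cast; simpa using hm)
  have hr := h.le_rate i j hij
  have hpos : 0 < ((((i : ℕ) + 1 : ℕ) : ℝ) ^ ((2 : ℝ) / 3)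
      - (((j : ℕ) + 1 : ℕ) : ℝ) ^ ((2 : ℝ) / 3)) ^ 2 := by
    refine sq_pos_of_ne_zero (sub_ne_zero.2 fun he => hij ?_)
    have := (Real.rpow_left_inj (by positivity) (by positivity) (by norm_num)).1 he
    exact Fin.ext (by exact_mod_cast add_right_cancel (Nat.cast_injective this))
  rw [div_le_iff₀ hpos] at hr
  have hB := h.rate_nonneg hb hij
  have : b ≤ m ^ ((4 : ℝ) / 3) * B i j := by nlinarith
  nlinarith [mul_le_mul_of_nonneg_right this (sq_nonneg (v i - v j))]

theorem le_two_mul_potential (h : IsCoefficient b B W) (hb : 0 < b) (i : Fin K) :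
    b ≤ 2 * (K : ℝ) ^ ((1 : ℝ) / 3) * W i := by
  have hK1 : 1 ≤ K := Nat.one_le_of_lt i.2
  have hK : (1 : ℝ) ≤ K := by exact_mod_cast hK1
  have hi : (((i : ℕ) + 1 : ℕ) : ℝ) < (K : ℝ) + 1 := by
    have := i.2
    exact_mod_cast (by omega : (i : ℕ) + 1 < K + 1)
  have hlt := Real.rpow_lt_rpow (by positivity) hi (by norm_num : (0 : ℝ) < 2 / 3)
  have h1 : ((K : ℝ) + 1) ^ ((2 : ℝ) / 3) ≤ 2 * (K : ℝ) ^ ((2 : ℝ) / 3) := by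
    have h2 := Real.rpow_add_le_add_rpow (by positivity : (0 : ℝ) ≤ K) zero_le_one
      (by norm_num : (0 : ℝ) ≤ 2 / 3) (by norm_num)
    have h3 := Real.one_le_rpow hK (by norm_num : (0 : ℝ) ≤ 2 / 3)
    simp only [Real.one_rpow] at h2
    linarith
  have hW := h.le_potential i
  have hnn : 0 ≤ (((i : ℕ) + 1 : ℕ) : ℝ) ^ ((2 : ℝ) / 3) := by positivity
  rw [div_le_iff₀ (by linarith)] at hW
  have hsq : (K : ℝ) ^ ((2 : ℝ) / 3) = (K : ℝ) ^ ((1 : ℝ) / 3) * (K : ℝ) ^ ((1 : ℝ) / 3) := by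
    rw [← Real.rpow_add (by positivity)]; norm_num
  have hKp : 0 < (K : ℝ) ^ ((1 : ℝ) / 3) := by positivity
  have hW0 : 0 ≤ W i := le_trans (by apply div_nonneg; positivity; linarith) (h.le_potential i)
  have h4 : b * (K : ℝ) ^ ((1 : ℝ) / 3) ≤
      (2 * (K : ℝ) ^ ((1 : ℝ) / 3) * W i) * (K : ℝ) ^ ((1 : ℝ) / 3) := by
    rw [hsq] at h1
    nlinarith
  exact le_of_mul_le_mul_right h4 hKp

theorem potential_nonneg (h : IsCoefficient b B W) (hb : 0 < b) (i : Fin K) : 0 ≤ W i := by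
  have hK : 0 < K := i.pos
  have := h.le_two_mul_potential hb i
  by_contra! hneg
  have : 0 < (K : ℝ) ^ ((1 : ℝ) / 3) := by positivity
  nlinarith

theorem dirichletForm_nonneg (h : IsCoefficient b B W) (hb : 0 < b) (v : Fin K → ℝ) :
    0 ≤ dirichletForm B W v :=
  add_nonneg (Finset.sum_nonneg fun i _ => Finset.sum_nonneg fun j _ =>
    h.rate_mul_sq_nonneg hb v i j) (mul_nonneg zero_le_two (Finset.sum_nonneg fun i _ =>
      mul_nonneg (h.potential_nonneg hb i) (sq_nonneg _)))

/-- Linearised Nash inequality: comparison with averages over `n` consecutive sites. -/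
theorem sum_sq_le (h : IsCoefficient b B W) (hb : 0 < b) {v : Fin K → ℝ} (hv : ∀ i, 0 ≤ v i)
    {n : ℕ} (hn : 0 < n) :
    ∑ i, v i ^ 2 ≤
      (n : ℝ) ^ ((1 : ℝ) / 3) / b * dirichletForm B W v + 2 * (∑ i, v i) ^ 2 / n := by
  have hn0 : (0 : ℝ) < n := by exact_mod_cast hn
  have hnp : 0 < (n : ℝ) ^ ((1 : ℝ) / 3) := by positivity
  have hBs : 0 ≤ ∑ i, ∑ j, B i j * (v i - v j) ^ 2 := Finset.sum_nonneg fun i _ =>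
    Finset.sum_nonneg fun j _ => h.rate_mul_sq_nonneg hb v i j
  have hWs : 0 ≤ ∑ i, W i * v i ^ 2 := Finset.sum_nonneg fun i _ =>
    mul_nonneg (h.potential_nonneg hb i) (sq_nonneg _)
  rcases le_or_gt n K with hnK | hnK
  · have hwin : ∀ i : Fin K, ∃ I : Finset (Fin K), I.card = n ∧
        ∀ j ∈ I, |((i : ℕ) : ℝ) - (j : ℕ)| ≤ n := by
      intro i
      have hi := i.2
      refine ⟨Finset.Icc ⟨min (i : ℕ) (K - n), by omega⟩
        ⟨min (i : ℕ) (K - n) + (n - 1), by omega⟩, ?_, ?_⟩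
      · rw [Fin.card_Icc]; simp only []; omega
      · intro j hj
        rw [Finset.mem_Icc, Fin.le_def, Fin.le_def] at hj
        simp only [] at hj
        have h1 : (i : ℕ) ≤ j + n := by omega
        have h2 : (j : ℕ) ≤ i + n := by omega
        have h1' : ((i : ℕ) : ℝ) ≤ (j : ℕ) + n := by exact_mod_cast h1
        have h2' : ((j : ℕ) : ℝ) ≤ (i : ℕ) + n := by exact_mod_cast h2
        rw [abs_le]; constructor <;> linarith
    have hpt : ∀ i, b * (n * v i ^ 2) ≤
        (n : ℝ) ^ ((4 : ℝ) / 3) * ∑ j, B i j * (v i - v j) ^ 2 + 2 * b * (v i * ∑ j, v j) := by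
      intro i
      obtain ⟨I, hI, hd⟩ := hwin i
      calc b * (n * v i ^ 2) = ∑ j ∈ I, b * v i ^ 2 := by
            rw [Finset.sum_const, hI, nsmul_eq_mul]; ring
        _ ≤ ∑ j ∈ I, ((n : ℝ) ^ ((4 : ℝ) / 3) * (B i j * (v i - v j) ^ 2)
              + 2 * b * (v i * v j)) := by
            refine Finset.sum_le_sum fun j hj => ?_
            have := h.mul_sq_le_of_abs_sub_le hb v (hd j hj)
            nlinarith [mul_nonneg hb.le (sq_nonneg (v j))]
        _ ≤ ∑ j, ((n : ℝ) ^ ((4 : ℝ) / 3) * (B i j * (v i - v j) ^ 2)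
              + 2 * b * (v i * v j)) := by
            refine Finset.sum_le_sum_of_subset_of_nonneg (Finset.subset_univ _) fun j _ _ => ?_
            have := h.rate_mul_sq_nonneg hb v i j
            have := mul_nonneg (hv i) (hv j)
            positivity
        _ = _ := by rw [Finset.sum_add_distrib, ← Finset.mul_sum, ← Finset.mul_sum,
              ← Finset.mul_sum]
    have hsum := Finset.sum_le_sum fun i (_ : i ∈ Finset.univ) => hpt i
    rw [Finset.sum_add_distrib, ← Finset.mul_sum, ← Finset.mul_sum, ← Finset.mul_sum,
      ← Finset.mul_sum, ← Finset.sum_mul] at hsum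
    have h43 : (n : ℝ) ^ ((4 : ℝ) / 3) = n * (n : ℝ) ^ ((1 : ℝ) / 3) := by
      rw [← Real.rpow_one_add' hn0.le (by norm_num)]; norm_num
    rw [h43] at hsum
    have hdiv : ∑ i, v i ^ 2 ≤ (n : ℝ) ^ ((1 : ℝ) / 3) / b *
        (∑ i, ∑ j, B i j * (v i - v j) ^ 2) + 2 * (∑ i, v i) ^ 2 / n := by
      have hbn : 0 < b * n := by positivity
      refine le_of_mul_le_mul_left ?_ hbn
      calc b * n * ∑ i, v i ^ 2 = b * (n * ∑ i, v i ^ 2) := by ring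
        _ ≤ _ := hsum
        _ = _ := by field_simp
    refine hdiv.trans ?_
    unfold dirichletForm
    gcongr
    linarith
  · have hKn : (K : ℝ) ^ ((1 : ℝ) / 3) ≤ (n : ℝ) ^ ((1 : ℝ) / 3) := by
      apply Real.rpow_le_rpow (by positivity) _ (by norm_num)
      exact_mod_cast hnK.le
    have hsum : ∑ i, v i ^ 2 ≤ (n : ℝ) ^ ((1 : ℝ) / 3) / b * (2 * ∑ i, W i * v i ^ 2) := by
      rw [Finset.mul_sum, Finset.mul_sum]
      refine Finset.sum_le_sum fun i _ => ?_
      have h1 := h.le_two_mul_potential hb i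
      have h2 := h.potential_nonneg hb i
      have h3 : b ≤ 2 * (n : ℝ) ^ ((1 : ℝ) / 3) * W i := h1.trans (by gcongr)
      rw [div_mul_eq_mul_div, le_div_iff₀ hb]
      nlinarith [mul_le_mul_of_nonneg_right h3 (sq_nonneg (v i))]
    unfold dirichletForm
    have h5 : 0 ≤ (n : ℝ) ^ ((1 : ℝ) / 3) / b * ∑ i, ∑ j, B i j * (v i - v j) ^ 2 := by positivity
    have h6 : 0 ≤ 2 * (∑ i, v i) ^ 2 / (n : ℝ) := by positivity
    rw [mul_add]
    linarith

/-- Nash inequality with exponent `6`. -/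
theorem nash (h : IsCoefficient b B W) (hb : 0 < b) {v : Fin K → ℝ} (hv : ∀ i, 0 ≤ v i)
    {M : ℝ} (hM : ∑ i, v i ≤ M) (hpos : 0 < ∑ i, v i ^ 2) :
    b / 4 * (M ^ 2) ^ (-(1 : ℝ) / 3) * (∑ i, v i ^ 2) ^ ((4 : ℝ) / 3) ≤ dirichletForm B W v := by
  set y := ∑ i, v i ^ 2 with hy
  have hS : 0 ≤ ∑ i, v i := Finset.sum_nonneg fun i _ => hv i
  have hyM : y ≤ M ^ 2 :=
    (Finset.sum_sq_le_sq_sum_of_nonneg fun i _ => hv i).trans (pow_le_pow_left₀ hS hM 2)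
  have hM2 : 0 < M ^ 2 := hpos.trans_le hyM
  set n := ⌈4 * M ^ 2 / y⌉₊ with hn
  have hq1 : 1 ≤ M ^ 2 / y := (one_le_div hpos).2 hyM
  have hn1 : 4 * M ^ 2 / y ≤ n := Nat.le_ceil _
  have hn2 : (n : ℝ) ≤ 8 * (M ^ 2 / y) := by
    have := (Nat.ceil_lt_add_one (by positivity : 0 ≤ 4 * M ^ 2 / y)).le
    have e : 4 * M ^ 2 / y = 4 * (M ^ 2 / y) := by ring
    rw [← hn] at this
    linarith
  have hn0 : (0 : ℝ) < n := lt_of_lt_of_le (by positivity) hn1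
  have hmain := h.sum_sq_le hb hv (n := n) (by exact_mod_cast hn0)
  have hD := h.dirichletForm_nonneg hb v
  have hA : 2 * (∑ i, v i) ^ 2 / n ≤ y / 2 := by
    rw [div_le_iff₀ hpos] at hn1
    rw [div_le_iff₀ hn0]
    nlinarith [pow_le_pow_left₀ hS hM 2]
  have hR : (n : ℝ) ^ ((1 : ℝ) / 3) ≤ 2 * (M ^ 2 / y) ^ ((1 : ℝ) / 3) := by
    refine (Real.rpow_le_rpow hn0.le hn2 (by norm_num)).trans_eq ?_
    rw [Real.mul_rpow (by norm_num) (by positivity)]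
    congr 1
    rw [show (8 : ℝ) = 2 ^ (3 : ℝ) by norm_num, ← Real.rpow_mul (by norm_num)]
    norm_num
  have hE : y / 2 ≤ 2 * (M ^ 2 / y) ^ ((1 : ℝ) / 3) / b * dirichletForm B W v := by
    have : (n : ℝ) ^ ((1 : ℝ) / 3) / b * dirichletForm B W v ≤
        2 * (M ^ 2 / y) ^ ((1 : ℝ) / 3) / b * dirichletForm B W v := by gcongr
    linarith
  set z := (M ^ 2) ^ ((1 : ℝ) / 3) with hz
  set x := y ^ ((1 : ℝ) / 3) with hx
  have hz0 : 0 < z := by positivity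
  have hx0 : 0 < x := by positivity
  have e1 : (M ^ 2) ^ (-(1 : ℝ) / 3) = z⁻¹ := by
    rw [hz, ← Real.rpow_neg hM2.le]; norm_num
  have e2 : y ^ ((4 : ℝ) / 3) = y * x := by
    rw [hx, ← Real.rpow_one_add' hpos.le (by norm_num)]; norm_num
  rw [Real.div_rpow hM2.le hpos.le, ← hz, ← hx] at hE
  rw [e1, e2]
  calc b / 4 * z⁻¹ * (y * x) = (b * x / (2 * z)) * (y / 2) := by field_simp; ring
    _ ≤ (b * x / (2 * z)) * (2 * (z / x) / b * dirichletForm B W v) := by gcongr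
    _ = _ := by field_simp

end IsCoefficient

/-- A nonnegative subsolution of the evolution generated by `B` and `W`. -/
structure IsSubsolution {K : ℕ} (B : ℝ → Fin K → Fin K → ℝ) (W v : ℝ → Fin K → ℝ) : Prop where
  nonneg : ∀ t, 0 ≤ t → ∀ i, 0 ≤ v t i
  continuousOn : ∀ i, ContinuousOn (fun t => v t i) (Set.Ici 0)
  exists_deriv_le : ∀ t, 0 < t → ∀ i, ∃ d, HasDerivAt (fun s => v s i) d t ∧
    d ≤ (∑ j, B t i j * (v t j - v t i)) - W t i * v t i

theorem antitoneOn_Ici_of_hasDerivAt {f f' : ℝ → ℝ} (hc : ContinuousOn f (Set.Ici 0))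
    (hd : ∀ t, 0 < t → HasDerivAt f (f' t) t) (hle : ∀ t, 0 < t → f' t ≤ 0) :
    AntitoneOn f (Set.Ici 0) := by
  refine antitoneOn_of_deriv_nonpos (convex_Ici 0) hc ?_ ?_ <;> rw [interior_Ici]
  · exact fun t ht => (hd t ht).differentiableAt.differentiableWithinAt
  · exact fun t ht => (hd t ht).deriv.trans_le (hle t ht)

/-- Integration of the differential inequality `y' ≤ -c * y ^ (4 / 3)`. -/
theorem mul_sub_le_rpow_of_deriv_le {y y' : ℝ → ℝ} {c s t : ℝ} (hst : s ≤ t)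
    (hpos : ∀ r ∈ Set.Icc s t, 0 < y r) (hc : ContinuousOn y (Set.Icc s t))
    (hd : ∀ r ∈ Set.Ioo s t, HasDerivAt y (y' r) r)
    (hle : ∀ r ∈ Set.Ioo s t, y' r ≤ -(c * y r ^ ((4 : ℝ) / 3))) :
    c / 3 * (t - s) ≤ y t ^ (-(1 : ℝ) / 3) := by
  have hg : ∀ r ∈ Set.Ioo s t, HasDerivAt (fun r => y r ^ (-(1 : ℝ) / 3) - c / 3 * r)
      (y' r * (-(1 : ℝ) / 3) * y r ^ (-(1 : ℝ) / 3 - 1) - c / 3 * 1) r := fun r hr =>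
    ((hd r hr).rpow_const (Or.inl (hpos r (Set.Ioo_subset_Icc_self hr)).ne')).sub
      ((hasDerivAt_id r).const_mul _)
  have hmono : MonotoneOn (fun r => y r ^ (-(1 : ℝ) / 3) - c / 3 * r) (Set.Icc s t) := by
    refine monotoneOn_of_deriv_nonneg (convex_Icc s t) ?_ ?_ ?_
    · exact (hc.rpow_const fun r hr => Or.inl (hpos r hr).ne').sub (by fun_prop)
    · rw [interior_Icc]
      exact fun r hr => (hg r hr).differentiableAt.differentiableWithinAt
    · rw [interior_Icc]
      intro r hr
      rw [(hg r hr).deriv]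
      have hy := hpos r (Set.Ioo_subset_Icc_self hr)
      have e : y r ^ ((4 : ℝ) / 3) * y r ^ (-(1 : ℝ) / 3 - 1) = 1 := by
        rw [← Real.rpow_add hy]; norm_num
      have hp : 0 < y r ^ (-(1 : ℝ) / 3 - 1) := by positivity
      have := mul_le_mul_of_nonneg_right (hle r hr) hp.le
      have e2 : -(c * y r ^ ((4 : ℝ) / 3)) * y r ^ (-(1 : ℝ) / 3 - 1) = -c := by
        linear_combination (-c) * e
      rw [e2] at this
      linarith
  have h1 := hmono (Set.left_mem_Icc.2 hst) (Set.right_mem_Icc.2 hst) hst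
  have h2 : 0 < y s ^ (-(1 : ℝ) / 3) := Real.rpow_pos_of_pos (hpos s (Set.left_mem_Icc.2 hst)) _
  simp only [] at h1
  linarith

theorem sum_sum_mul_sub_eq_zero {ι : Type*} [Fintype ι] {A : ι → ι → ℝ}
    (hA : ∀ i j, A i j = A j i) (v : ι → ℝ) : ∑ i, ∑ j, A i j * (v j - v i) = 0 := by
  have h : ∑ i, ∑ j, A i j * (v j - v i) = -∑ i, ∑ j, A i j * (v j - v i) := by
    conv_lhs => rw [Finset.sum_comm]
    rw [← Finset.sum_neg_distrib]
    refine Finset.sum_congr rfl fun i _ => ?_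
    rw [← Finset.sum_neg_distrib]
    refine Finset.sum_congr rfl fun j _ => ?_
    rw [hA j i]; ring
  linarith

theorem two_mul_sum_mul_generator {K : ℕ} {B : Fin K → Fin K → ℝ} (hB : ∀ i j, B i j = B j i)
    (W v : Fin K → ℝ) :
    ∑ i, 2 * v i * ((∑ j, B i j * (v j - v i)) - W i * v i) = -dirichletForm B W v := by
  have h := sum_sum_mul_sub_eq_zero hB fun i => v i ^ 2
  have e : ∀ i, 2 * v i * ((∑ j, B i j * (v j - v i)) - W i * v i) =
      ((∑ j, B i j * (v j ^ 2 - v i ^ 2)) - ∑ j, B i j * (v i - v j) ^ 2)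
        - 2 * (W i * v i ^ 2) := by
    intro i
    rw [← Finset.sum_sub_distrib, mul_sub, Finset.mul_sum]
    congr 1
    · exact Finset.sum_congr rfl fun j _ => by ring
    · ring
  simp only [e, Finset.sum_sub_distrib, h, dirichletForm, Finset.mul_sum]
  ring

namespace IsSubsolution

variable {K : ℕ} {b : ℝ} {B : ℝ → Fin K → Fin K → ℝ} {W v : ℝ → Fin K → ℝ}

theorem antitoneOn_sum (hv : IsSubsolution B W v) (hb : 0 < b)
    (hc : ∀ t, 0 ≤ t → IsCoefficient b (B t) (W t)) :
    AntitoneOn (fun t => ∑ i, v t i) (Set.Ici 0) := by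
  choose! d hd hle using hv.exists_deriv_le
  refine antitoneOn_Ici_of_hasDerivAt (f' := fun t => ∑ i, d t i)
    (continuousOn_finsetSum _ fun i _ => hv.continuousOn i)
    (fun t ht => HasDerivAt.fun_sum fun i _ => hd t ht i) fun t ht => ?_
  refine (Finset.sum_le_sum fun i _ => hle t ht i).trans ?_
  rw [Finset.sum_sub_distrib, sum_sum_mul_sub_eq_zero (hc t ht.le).symm, zero_sub,
    neg_nonpos]
  exact Finset.sum_nonneg fun i _ =>
    mul_nonneg ((hc t ht.le).potential_nonneg hb i) (hv.nonneg t ht.le i)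

theorem sq (hv : IsSubsolution B W v) (hb : 0 < b)
    (hc : ∀ t, 0 ≤ t → IsCoefficient b (B t) (W t)) :
    IsSubsolution B W fun t i => v t i ^ 2 where
  nonneg t _ i := sq_nonneg _
  continuousOn i := (hv.continuousOn i).pow 2
  exists_deriv_le t ht i := by
    obtain ⟨d, hd, hle⟩ := hv.exists_deriv_le t ht i
    refine ⟨2 * v t i * d, by simpa using hd.fun_pow 2, ?_⟩
    have hvi := hv.nonneg t ht.le i
    have hW := (hc t ht.le).potential_nonneg hb i
    calc 2 * v t i * d ≤ 2 * v t i * ((∑ j, B t i j * (v t j - v t i)) - W t i * v t i) := by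
          gcongr
      _ = (∑ j, (B t i j * (v t j ^ 2 - v t i ^ 2) - B t i j * (v t i - v t j) ^ 2))
          - 2 * (W t i * v t i ^ 2) := by
          rw [mul_sub, Finset.mul_sum]
          congr 1
          · exact Finset.sum_congr rfl fun j _ => by ring
          · ring
      _ ≤ _ := by
          have h1 : 0 ≤ W t i * v t i ^ 2 := by positivity
          have h2 : ∑ j, (B t i j * (v t j ^ 2 - v t i ^ 2) - B t i j * (v t i - v t j) ^ 2) ≤
              ∑ j, B t i j * (v t j ^ 2 - v t i ^ 2) := Finset.sum_le_sum fun j _ =>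
            sub_le_self _ ((hc t ht.le).rate_mul_sq_nonneg hb (v t) i j)
          linarith

theorem sum_sq_decay (hv : IsSubsolution B W v) (hb : 0 < b)
    (hc : ∀ t, 0 ≤ t → IsCoefficient b (B t) (W t)) {s t : ℝ} (hs : 0 ≤ s) (hst : s ≤ t) :
    (∑ i, v t i ^ 2) * (b * (t - s)) ^ 3 ≤ 12 ^ 3 * (∑ i, v s i) ^ 2 := by
  have hanti := (hv.sq hb hc).antitoneOn_sum hb hc
  have ht : 0 ≤ t := hs.trans hst
  have hy0 : 0 ≤ ∑ i, v t i ^ 2 := Finset.sum_nonneg fun i _ => sq_nonneg _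
  rcases hy0.eq_or_lt with h0 | h0
  · rw [← h0, zero_mul]; positivity
  choose! d hd _ using (hv.sq hb hc).exists_deriv_le
  choose! e he hle using hv.exists_deriv_le
  have hpos : ∀ r ∈ Set.Icc s t, 0 < ∑ i, v r i ^ 2 := fun r hr =>
    h0.trans_le (hanti (hs.trans hr.1) ht hr.2)
  set M := ∑ i, v s i with hM
  have hy : b / 4 * (M ^ 2) ^ (-(1 : ℝ) / 3) / 3 * (t - s) ≤
      (∑ i, v t i ^ 2) ^ (-(1 : ℝ) / 3) := by
    refine mul_sub_le_rpow_of_deriv_le (y := fun t => ∑ i, v t i ^ 2)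
      (y' := fun r => ∑ i, 2 * v r i * e r i) hst hpos
      ((continuousOn_finsetSum _ fun i _ => (hv.continuousOn i).pow 2).mono
        fun r hr => hs.trans hr.1) (fun r hr => ?_) fun r hr => ?_
    · exact HasDerivAt.fun_sum fun i _ => by
        simpa using (he r (hs.trans_lt hr.1) i).fun_pow 2
    · have hr0 : 0 < r := hs.trans_lt hr.1
      have hnash := (hc r hr0.le).nash hb (hv.nonneg r hr0.le)
        (hv.antitoneOn_sum hb hc hs hr0.le hr.1.le) (hpos r (Set.Ioo_subset_Icc_self hr))
      have hdr : ∑ i, 2 * v r i * e r i ≤ -dirichletForm (B r) (W r) (v r) := by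
        rw [← two_mul_sum_mul_generator (hc r hr0.le).symm]
        refine Finset.sum_le_sum fun i _ => ?_
        have := hv.nonneg r hr0.le i
        have := hle r hr0 i
        gcongr
      exact hdr.trans (neg_le_neg hnash)
  have hM2 : 0 < M ^ 2 := (hpos s (Set.left_mem_Icc.2 hst)).trans_le
    (Finset.sum_sq_le_sq_sum_of_nonneg fun i _ => hv.nonneg s hs i)
  set Y := ∑ i, v t i ^ 2 with hY
  have hts : 0 ≤ t - s := sub_nonneg.2 hst
  have hcube : ∀ x : ℝ, 0 < x → (x ^ (-(1 : ℝ) / 3)) ^ 3 = x⁻¹ := fun x hx => by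
    rw [← Real.rpow_natCast, ← Real.rpow_mul hx.le, ← Real.rpow_neg_one]; norm_num
  have h3 := pow_le_pow_left₀ (by positivity) hy 3
  rw [hcube Y h0, show b / 4 * (M ^ 2) ^ (-(1 : ℝ) / 3) / 3 * (t - s) =
    (M ^ 2) ^ (-(1 : ℝ) / 3) * (b * (t - s)) / 12 by ring, div_pow, mul_pow, hcube _ hM2] at h3
  rw [div_le_iff₀ (by positivity), inv_mul_eq_div, inv_mul_eq_div, div_le_div_iff₀ hM2 h0] at h3
  linarith

theorem apply_le_sum (hv : IsSubsolution B W v) {t : ℝ} (ht : 0 ≤ t) (i : Fin K) :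
    v t i ≤ ∑ i, v t i :=
  Finset.single_le_sum (f := v t) (fun j _ => hv.nonneg t ht j) (Finset.mem_univ i)

/-- Ultracontractivity, from a self-improving bound under squaring. -/
theorem sup_decay (hv : IsSubsolution B W v) (hb : 0 < b)
    (hc : ∀ t, 0 ≤ t → IsCoefficient b (B t) (W t)) {s t : ℝ} (hs : 0 ≤ s) (hst : s ≤ t)
    (i : Fin K) : v t i * (b * (t - s)) ^ 3 ≤ 48 ^ 3 * ∑ i, v s i := by
  set L := (b * t) ^ 3 with hL
  have hiter : ∀ k : ℕ, ∀ u : ℝ → Fin K → ℝ, IsSubsolution B W u → ∀ r x, 0 ≤ r → r ≤ x → x ≤ t →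
      ∀ i, u x i * (b * (x - r)) ^ 3 ≤ 48 ^ 3 * Real.exp (L * (1 / 2) ^ k) * ∑ i, u r i := by
    intro k
    induction k with
    | zero =>
      intro u hu r x hr hrx hxt i
      have h1 : u x i ≤ ∑ i, u r i := (hu.apply_le_sum (hr.trans hrx) i).trans
        (hu.antitoneOn_sum hb hc hr (hr.trans hrx) hrx)
      have h0 := hu.nonneg x (hr.trans hrx) i
      have hxr : 0 ≤ x - r := sub_nonneg.2 hrx
      have h2 : (b * (x - r)) ^ 3 ≤ L := by
        rw [hL]; gcongr; linarith
      have h3 : L ≤ 48 ^ 3 * Real.exp (L * (1 / 2) ^ 0) := by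
        have := Real.add_one_le_exp L
        have := Real.exp_pos L
        simp only [pow_zero, mul_one]
        linarith
      have hS := h0.trans h1
      calc u x i * (b * (x - r)) ^ 3 ≤ (∑ i, u r i) * L := by gcongr
        _ ≤ (∑ i, u r i) * (48 ^ 3 * Real.exp (L * (1 / 2) ^ 0)) := by gcongr
        _ = _ := by ring
    | succ k ih =>
      intro u hu r x hr hrx hxt i
      set m := (r + x) / 2 with hm
      have h1 := ih _ (hu.sq hb hc) m x (by linarith) (by linarith) hxt i
      have h2 := hu.sum_sq_decay hb hc hr (by linarith : r ≤ m)
      rw [show x - m = (x - r) / 2 by rw [hm]; ring] at h1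
      rw [show m - r = (x - r) / 2 by rw [hm]; ring] at h2
      have hxr : 0 ≤ x - r := sub_nonneg.2 hrx
      have he : Real.exp (L * (1 / 2) ^ k) = Real.exp (L * (1 / 2) ^ (k + 1)) ^ 2 := by
        rw [← Real.exp_nat_mul]; congr 1; push_cast; ring
      have hS : 0 ≤ ∑ i, u r i := Finset.sum_nonneg fun i _ => hu.nonneg r hr i
      refine le_of_sq_le_sq ?_ (by positivity)
      rw [he] at h1
      set E := Real.exp (L * (1 / 2) ^ (k + 1))
      calc (u x i * (b * (x - r)) ^ 3) ^ 2
          = 64 * ((u x i ^ 2 * (b * ((x - r) / 2)) ^ 3) * (b * ((x - r) / 2)) ^ 3) := by ring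
        _ ≤ 64 * ((48 ^ 3 * E ^ 2 * ∑ i, u m i ^ 2) * (b * ((x - r) / 2)) ^ 3) := by gcongr
        _ = 64 * (48 ^ 3 * E ^ 2) * ((∑ i, u m i ^ 2) * (b * ((x - r) / 2)) ^ 3) := by ring
        _ ≤ 64 * (48 ^ 3 * E ^ 2) * (12 ^ 3 * (∑ i, u r i) ^ 2) := by gcongr
        _ = _ := by ring
  have hlim : Filter.Tendsto (fun k : ℕ => 48 ^ 3 * Real.exp (L * (1 / 2) ^ k) * ∑ i, v s i)
      Filter.atTop (nhds (48 ^ 3 * Real.exp (L * 0) * ∑ i, v s i)) :=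
    (((Real.continuous_exp.tendsto _).comp ((tendsto_pow_atTop_nhds_zero_of_lt_one (by norm_num)
      (by norm_num)).const_mul L)).const_mul _).mul_const _
  have := ge_of_tendsto' hlim fun k => hiter k v hv s t hs hst le_rfl i
  simpa using this

end IsSubsolution

theorem mul_abs_rpow_mul_self {p : ℝ} (hp : 1 < p) (x : ℝ) : |x| ^ (p - 2) * x * x = |x| ^ p := by
  rcases eq_or_ne x 0 with rfl | hx
  · simp [Real.zero_rpow (by linarith : p ≠ 0)]
  · rw [mul_assoc, ← sq, ← sq_abs, ← Real.rpow_natCast, ← Real.rpow_add (abs_pos.2 hx)]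
    norm_num

/-- The tangent line inequality for the convex function `x ↦ |x| ^ p`. -/
theorem mul_sub_le_abs_rpow_sub {p : ℝ} (hp : 1 < p) (x y : ℝ) :
    p * |x| ^ (p - 2) * x * (y - x) ≤ |y| ^ p - |x| ^ p := by
  have hpq := Real.HolderConjugate.conjExponent hp
  have hp0 : 0 < p := by linarith
  have hy := Real.young_inequality y (|x| ^ (p - 2) * x) hpq
  have hg : |(|x| ^ (p - 2) * x)| ^ p.conjExponent = |x| ^ p := by
    rcases eq_or_ne x 0 with rfl | hx
    · simp [Real.zero_rpow hp0.ne', Real.zero_rpow hpq.symm.ne_zero]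
    · have hx0 := abs_pos.2 hx
      rw [abs_mul, abs_of_nonneg (by positivity : 0 ≤ |x| ^ (p - 2)),
        ← Real.rpow_add_one hx0.ne', ← Real.rpow_mul hx0.le]
      congr 1
      rw [Real.conjExponent]
      have : p - 1 ≠ 0 := by linarith
      field_simp
      ring
  rw [hg] at hy
  have hq : 1 / p.conjExponent = 1 - 1 / p := by
    have := hpq.inv_add_inv_eq_one
    rw [one_div, one_div]
    linarith
  rw [div_eq_mul_one_div (|x| ^ p), hq] at hy
  have hxx := mul_abs_rpow_mul_self hp x
  have hmul := mul_le_mul_of_nonneg_left hy hp0.le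
  have e : p * (|y| ^ p / p + |x| ^ p * (1 - 1 / p)) = |y| ^ p + (p - 1) * |x| ^ p := by
    field_simp
  rw [e] at hmul
  linear_combination hmul - p * hxx

theorem le_of_forall_one_lt {f g : ℝ → ℝ} (hf : ContinuousAt f 1) (hg : ContinuousAt g 1)
    (h : ∀ p, 1 < p → f p ≤ g p) {p : ℝ} (hp : 1 ≤ p) : f p ≤ g p := by
  rcases hp.eq_or_lt with rfl | hp
  · exact le_of_tendsto_of_tendsto (hf.tendsto.mono_left nhdsWithin_le_nhds)
      (hg.tendsto.mono_left nhdsWithin_le_nhds)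
      (eventually_nhdsWithin_of_forall (s := Set.Ioi 1) h)
  · exact h p hp

theorem continuousAt_abs_rpow (x : ℝ) : ContinuousAt (fun p : ℝ => |x| ^ p) 1 :=
  continuousAt_const.rpow continuousAt_id (Or.inr one_pos)

/-- A solution of the evolution generated by `B` and `W`. -/
structure IsSolution {K : ℕ} (B : ℝ → Fin K → Fin K → ℝ) (W w : ℝ → Fin K → ℝ) : Prop where
  continuousOn : ∀ i, ContinuousOn (fun t => w t i) (Set.Ici 0)
  hasDerivAt : ∀ t, 0 < t → ∀ i, HasDerivAt (fun s => w s i)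
    ((∑ j, B t i j * (w t j - w t i)) - W t i * w t i) t

namespace IsSolution

variable {K : ℕ} {b : ℝ} {B : ℝ → Fin K → Fin K → ℝ} {W w : ℝ → Fin K → ℝ}

theorem isSubsolution_abs_rpow (hw : IsSolution B W w) (hb : 0 < b)
    (hc : ∀ t, 0 ≤ t → IsCoefficient b (B t) (W t)) {p : ℝ} (hp : 1 < p) :
    IsSubsolution B W fun t i => |w t i| ^ p where
  nonneg t _ i := by positivity
  continuousOn i := (hw.continuousOn i).abs.rpow_const fun _ _ => Or.inr (by linarith)
  exists_deriv_le t ht i := by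
    have hd : HasDerivAt ((fun x => |x| ^ p) ∘ fun s => w s i) _ t :=
      (hasDerivAt_abs_rpow (w t i) hp).comp t (hw.hasDerivAt t ht i)
    refine ⟨_, hd, ?_⟩
    rw [mul_sub, Finset.mul_sum]
    have hxx := mul_abs_rpow_mul_self hp (w t i)
    have hx : 0 ≤ |w t i| ^ p := by positivity
    refine sub_le_sub (Finset.sum_le_sum fun j _ => ?_) ?_
    · rcases eq_or_ne i j with rfl | hij
      · simp
      · have := mul_le_mul_of_nonneg_left (mul_sub_le_abs_rpow_sub hp (w t i) (w t j))
          ((hc t ht.le).rate_nonneg hb hij)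
        linarith
    · have hW := (hc t ht.le).potential_nonneg hb i
      have e : p * |w t i| ^ (p - 2) * w t i * (W t i * w t i) = p * (W t i * |w t i| ^ p) := by
        rw [← hxx]; ring
      rw [e]
      nlinarith [mul_nonneg hW hx]

theorem sum_abs_rpow_le (hw : IsSolution B W w) (hb : 0 < b)
    (hc : ∀ t, 0 ≤ t → IsCoefficient b (B t) (W t)) {p : ℝ} (hp : 1 ≤ p) {t : ℝ} (ht : 0 ≤ t) :
    ∑ i, |w t i| ^ p ≤ ∑ i, |w 0 i| ^ p :=
  le_of_forall_one_lt (f := fun p => ∑ i, |w t i| ^ p) (g := fun p => ∑ i, |w 0 i| ^ p)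
    (tendsto_finsetSum _ fun i _ => continuousAt_abs_rpow (w t i))
    (tendsto_finsetSum _ fun i _ => continuousAt_abs_rpow (w 0 i))
    (fun _ hp => (hw.isSubsolution_abs_rpow hb hc hp).antitoneOn_sum hb hc
      Set.self_mem_Ici ht ht) hp

theorem abs_rpow_mul_le (hw : IsSolution B W w) (hb : 0 < b)
    (hc : ∀ t, 0 ≤ t → IsCoefficient b (B t) (W t)) {p : ℝ} (hp : 1 ≤ p) {t : ℝ} (ht : 0 ≤ t)
    (i : Fin K) : |w t i| ^ p * (b * t) ^ 3 ≤ 48 ^ 3 * ∑ i, |w 0 i| ^ p :=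
  le_of_forall_one_lt (f := fun p => |w t i| ^ p * (b * t) ^ 3)
    (g := fun p => 48 ^ 3 * ∑ i, |w 0 i| ^ p)
    ((continuousAt_abs_rpow (w t i)).mul_const _)
    (Filter.Tendsto.const_mul _ (tendsto_finsetSum _ fun i _ => continuousAt_abs_rpow (w 0 i)))
    (fun _ hp => by
      simpa using (hw.isSubsolution_abs_rpow hb hc hp).sup_decay hb hc le_rfl ht i) hp

theorem abs_le_of_forall_abs_le (hw : IsSolution B W w) (hb : 0 < b)
    (hc : ∀ t, 0 ≤ t → IsCoefficient b (B t) (W t)) {S : ℝ} (hS : ∀ j, |w 0 j| ≤ S) {t : ℝ}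
    (ht : 0 ≤ t) (i : Fin K) : |w t i| ≤ S := by
  have hS0 : 0 ≤ S := (abs_nonneg _).trans (hS i)
  have hpow : ∀ n : ℕ, |w t i| ^ (n + 1) ≤ K * S ^ (n + 1) := by
    intro n
    have h := hw.sum_abs_rpow_le hb hc (p := (n + 1 : ℕ)) (by norm_num) ht
    simp only [Real.rpow_natCast] at h
    calc |w t i| ^ (n + 1) ≤ ∑ i, |w t i| ^ (n + 1) :=
          Finset.single_le_sum (f := fun i => |w t i| ^ (n + 1)) (fun j _ => by positivity)
            (Finset.mem_univ i)
      _ ≤ ∑ i, |w 0 i| ^ (n + 1) := h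
      _ ≤ ∑ _i : Fin K, S ^ (n + 1) := by gcongr with j; exact hS j
      _ = _ := by simp
  by_contra! hlt
  rcases hS0.eq_or_lt with rfl | hS0
  · have := hpow 0
    simp at this
    simp [this] at hlt
  · have hx : 1 < |w t i| / S := (one_lt_div hS0).2 hlt
    obtain ⟨n, hn⟩ := pow_unbounded_of_one_lt (K : ℝ) hx
    have h1 := hpow n
    rw [← div_le_iff₀ (by positivity), ← div_pow] at h1
    exact absurd (hn.trans_le ((pow_le_pow_right₀ hx.le n.le_succ).trans h1)) (lt_irrefl _)

theorem abs_le_mul_rpow (hw : IsSolution B W w) (hb : 0 < b)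
    (hc : ∀ t, 0 ≤ t → IsCoefficient b (B t) (W t)) {p : ℝ} (hp : 1 ≤ p) {t : ℝ} (ht : 0 < t)
    (i : Fin K) :
    |w t i| ≤ min 1 (48 / (b * t)) ^ (3 / p) * (∑ i, |w 0 i| ^ p) ^ (1 / p) := by
  have hp0 : 0 < p := by linarith
  have hbt : 0 < b * t := by positivity
  have hS : 0 ≤ ∑ i, |w 0 i| ^ p := Finset.sum_nonneg fun i _ => by positivity
  have h1 : |w t i| ^ p ≤ ∑ i, |w 0 i| ^ p :=
    (Finset.single_le_sum (f := fun i => |w t i| ^ p) (fun j _ => by positivity)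
      (Finset.mem_univ i)).trans (hw.sum_abs_rpow_le hb hc hp ht.le)
  have h2 := hw.abs_rpow_mul_le hb hc hp ht.le i
  have hm : 0 < min 1 (48 / (b * t)) := by positivity
  have h3 : |w t i| ^ p ≤ min 1 (48 / (b * t)) ^ 3 * ∑ i, |w 0 i| ^ p := by
    rcases min_choice 1 (48 / (b * t)) with h | h <;> rw [h]
    · simpa using h1
    · rw [div_pow, div_mul_eq_mul_div, le_div_iff₀ (by positivity)]
      exact h2
  have h4 := Real.rpow_le_rpow (by positivity) h3 (by positivity : 0 ≤ 1 / p)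
  rw [← Real.rpow_mul (abs_nonneg _), mul_one_div_cancel hp0.ne', Real.rpow_one,
    Real.mul_rpow (by positivity) hS, ← Real.rpow_natCast, ← Real.rpow_mul hm.le] at h4
  simpa [div_eq_mul_inv] using h4

theorem lpNorm_le (hw : IsSolution B W w) (hK : 1 ≤ K) (hb : 0 < b)
    (hc : ∀ t, 0 ≤ t → IsCoefficient b (B t) (W t)) {p q : ℝ≥0∞} (hp : 1 ≤ p) (hpq : p ≤ q)
    {t : ℝ} (ht : 0 < t) :
    lpNorm q (w t) ≤ min 1 (48 / (b * t)) ^ (3 / p.toReal - 3 / q.toReal) * lpNorm p (w 0) := by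
  have : Nonempty (Fin K) := ⟨⟨0, hK⟩⟩
  have hm : 0 < min 1 (48 / (b * t)) := by positivity
  unfold lpNorm
  rcases eq_or_ne p ⊤ with rfl | hp'
  · obtain rfl := top_le_iff.1 hpq
    simp only [if_true, sub_self, Real.rpow_zero, one_mul]
    exact ciSup_le fun i => hw.abs_le_of_forall_abs_le hb hc
      (fun j => le_ciSup (f := fun j => |w 0 j|) (Set.finite_range _).bddAbove j) ht.le i
  have hp1 : 1 ≤ p.toReal := by
    simpa using (ENNReal.toReal_le_toReal ENNReal.one_ne_top hp').2 hp
  have hsup := fun i => hw.abs_le_mul_rpow hb hc hp1 ht i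
  rw [if_neg hp']
  rcases eq_or_ne q ⊤ with rfl | hq'
  · simpa using ciSup_le hsup
  have hpq' : p.toReal ≤ q.toReal := (ENNReal.toReal_le_toReal hp' hq').2 hpq
  rw [if_neg hq']
  have hsum := hw.sum_abs_rpow_le hb hc hp1 ht.le
  generalize p.toReal = p at *
  generalize q.toReal = q at *
  generalize min 1 (48 / (b * t)) = m at *
  have hS : 0 ≤ ∑ i, |w 0 i| ^ p := Finset.sum_nonneg fun i _ => by positivity
  set S := ∑ i, |w 0 i| ^ p
  have hp0 : 0 < p := by linarith
  have hq0 : 0 < q := by linarith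
  have hle : ∑ i, |w t i| ^ q ≤ (m ^ (3 / p) * S ^ (1 / p)) ^ (q - p) * S := by
    calc ∑ i, |w t i| ^ q = ∑ i, |w t i| ^ (q - p) * |w t i| ^ p := by
          refine Finset.sum_congr rfl fun i _ => ?_
          rw [← Real.rpow_add_of_nonneg (abs_nonneg _) (by linarith) hp0.le, sub_add_cancel]
      _ ≤ ∑ i, (m ^ (3 / p) * S ^ (1 / p)) ^ (q - p) * |w t i| ^ p := by
          gcongr with i
          exact hsup i
      _ ≤ _ := by rw [← Finset.mul_sum]; gcongr
  have h := Real.rpow_le_rpow (Finset.sum_nonneg fun i _ => by positivity) hle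
    (by positivity : 0 ≤ 1 / q)
  refine h.trans_eq ?_
  rw [Real.mul_rpow (by positivity) hS, ← Real.rpow_mul (by positivity),
    Real.mul_rpow (by positivity) (by positivity), ← Real.rpow_mul hm.le,
    ← Real.rpow_mul hS, mul_assoc,
    ← Real.rpow_add_of_nonneg hS
      (mul_nonneg (by positivity) (mul_nonneg (by linarith) (by positivity))) (by positivity)]
  congr 2 <;> field_simp
  ring

end IsSolution

theorem min_one_div_le_mul_rpow {T x c θ : ℝ} (hT : 0 < T) (hTx : T ≤ x) (hc : 1 ≤ c)
    (h0 : 0 ≤ θ) (h1 : θ ≤ 1) : min 1 (c / x) ≤ c * T ^ (-θ) := by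
  rcases le_total T 1 with hT1 | hT1
  · exact (min_le_left _ _).trans
      (one_le_mul_of_one_le_of_one_le hc (Real.one_le_rpow_of_pos_of_le_one_of_nonpos hT hT1
        (by linarith)))
  · refine (min_le_right _ _).trans ?_
    rw [div_eq_mul_inv]
    gcongr
    calc x⁻¹ ≤ T⁻¹ := by gcongr
      _ = T ^ (-1 : ℝ) := (Real.rpow_neg_one T).symm
      _ ≤ T ^ (-θ) := Real.rpow_le_rpow_of_exponent_le hT1 (by linarith)

/-- Energy/decay estimate for the parabolic evolution
(Proposition 10.4 of Bourgade–Erdős–Yau). -/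
theorem parabolic_decay_estimate (p q : ℝ≥0∞) (hp : 1 ≤ p) (hpq : p ≤ q) :
    ∃ η₀ : ℝ, 0 < η₀ ∧
      ∀ η : ℝ, 0 < η → η ≤ η₀ →
      ∃ C : ℝ, 0 < C ∧
      ∀ K : ℕ, 1 ≤ K →
      ∀ b : ℝ, 0 < b →
      ∀ B : ℝ → Fin K → Fin K → ℝ, ∀ W : ℝ → Fin K → ℝ, ∀ w : ℝ → Fin K → ℝ,
      (∀ j k : Fin K, Continuous fun t => B t j k) →
      (∀ j : Fin K, Continuous fun t => W t j) →
      (∀ t : ℝ, 0 ≤ t → ∀ j k : Fin K, j ≠ k →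
        B t j k = B t k j ∧
          b / ((((j : ℕ) + 1 : ℕ) : ℝ) ^ ((2 : ℝ) / 3)
              - (((k : ℕ) + 1 : ℕ) : ℝ) ^ ((2 : ℝ) / 3)) ^ 2 ≤ B t j k) →
      (∀ t : ℝ, 0 ≤ t → ∀ j : Fin K,
        b * (K : ℝ) ^ ((1 : ℝ) / 3) /
            (((K : ℝ) + 1) ^ ((2 : ℝ) / 3) - (((j : ℕ) + 1 : ℕ) : ℝ) ^ ((2 : ℝ) / 3)) ≤
          W t j) →
      (∀ i : Fin K, ContinuousOn (fun t => w t i) (Set.Ici 0)) →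
      (∀ t : ℝ, 0 < t → ∀ i : Fin K,
        HasDerivAt (fun s => w s i)
          ((∑ j ∈ Finset.univ.erase i, B t i j * (w t j - w t i)) - W t i * w t i) t) →
      ∀ t : ℝ, 0 < t →
        lpNorm q (w t) ≤
          C * (((K : ℝ) ^ (-(2 : ℝ) * η / 3) * t * b) ^
              (-(3 / p.toReal - 3 / q.toReal))) ^ (1 - 6 * η) * lpNorm p (w 0) := by
  set α := 3 / p.toReal - 3 / q.toReal with hα
  refine ⟨1 / 6, by norm_num, fun η hη hη6 => ⟨48 ^ α, by positivity, ?_⟩⟩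
  intro K hK b hb B W w _ _ hB hW hwc hwd t ht
  have hc : ∀ t, 0 ≤ t → IsCoefficient b (B t) (W t) := fun t ht =>
    { symm := fun j k => by
        rcases eq_or_ne j k with rfl | hjk
        · rfl
        · exact (hB t ht j k hjk).1
      le_rate := fun j k hjk => (hB t ht j k hjk).2
      le_potential := hW t ht }
  have hw : IsSolution B W w :=
    { continuousOn := hwc
      hasDerivAt := fun t ht i => by
        simpa [Finset.sum_erase] using hwd t ht i }
  have hα0 : 0 ≤ α := by
    rcases eq_or_ne q ⊤ with rfl | hq
    · simp only [hα, ENNReal.toReal_top, div_zero, sub_zero]; positivity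
    · have hp' : p ≠ ⊤ := ne_top_of_le_ne_top hq hpq
      have hp0 : 0 < p.toReal := ENNReal.toReal_pos (by positivity) hp'
      have := (ENNReal.toReal_le_toReal hp' hq).2 hpq
      exact sub_nonneg.2 (by gcongr)
  have hK0 : (1 : ℝ) ≤ K := by exact_mod_cast hK
  set T := (K : ℝ) ^ (-(2 : ℝ) * η / 3) * t * b with hT
  have hT0 : 0 < T := by positivity
  have hTle : T ≤ b * t := by
    have := Real.rpow_le_one_of_one_le_of_nonpos hK0 (by linarith : -(2 : ℝ) * η / 3 ≤ 0)
    rw [hT, mul_assoc, mul_comm b t]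
    exact mul_le_of_le_one_left (by positivity) this
  have hN : 0 ≤ lpNorm p (w 0) := by
    unfold lpNorm
    split_ifs
    · exact Real.iSup_nonneg fun i => abs_nonneg _
    · positivity
  refine (hw.lpNorm_le hK hb hc hp hpq ht).trans ?_
  refine mul_le_mul_of_nonneg_right ?_ hN
  have hmin := min_one_div_le_mul_rpow hT0 hTle (by norm_num : (1 : ℝ) ≤ 48)
    (by linarith : 0 ≤ 1 - 6 * η) (by linarith)
  calc min 1 (48 / (b * t)) ^ α ≤ (48 * T ^ (-(1 - 6 * η))) ^ α := by gcongr
    _ = 48 ^ α * (T ^ (-α)) ^ (1 - 6 * η) := by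
      rw [Real.mul_rpow (by norm_num) (by positivity), ← Real.rpow_mul hT0.le,
        ← Real.rpow_mul hT0.le]
      congr 2
      ring
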